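/- (Planar case of Theorem 3.1, Mergelyan's theorem for complete minimal surfaces of finite total curvature, for a compact domain without arcs.) Let n ≥ 3, let K ⊂ ℂ be a connected compact set, let E₀ and Λ be disjoint finite subsets of K, let W be an open neighborhood of K, and let X : W \ E₀ → ℝⁿ be a conformal minimal immersion such that each component of ∂X extends meromorphically to every p ∈ E₀ and at each p ∈ E₀ at least one component of ∂X has a pole. Then for every ε > 0 and every integer r ≥ 0 there exist an open neighborhood W′ ⊆ W of K and a conformal minimal immersion Y : W′ \ E₀ → ℝⁿ such that: (i) ∂Y is full, i.e. its image is contained in no affine complex hyperplane of ℂⁿ; (ii) each component of ∂Y is meromorphic at every p ∈ E₀, at each p ∈ E₀ at least one component of ∂Y has a pole, and ∂Y − ∂X extends holomorphically to W′ (across E₀); (iii) Y − X extends continuously to K and sup_K ‖Y − X‖ < ε; (iv) for every p ∈ E₀ ∪ Λ one has ‖Y(z) − X(z)‖ = O(|z − p|^r) as z → p; (v) ∂Y − ∂X admits a holomorphic primitive on W′ \ E₀ (equivalently, Y has the same flux map as X). -/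

import Mathlib

open Complex Filter
open scoped Topology

noncomputable section

/-- Wirtinger-type derivative data `∂u = ∂u/∂x − i·∂u/∂y` of a real function on `ℂ`. -/
def wirt (u : ℂ → ℝ) (z : ℂ) : ℂ :=
  ((fderiv ℝ u z 1 : ℝ) : ℂ) - Complex.I * ((fderiv ℝ u z Complex.I : ℝ) : ℂ)

/-- The derivative data `∂X : O → ℂⁿ` of a map `X : ℂ → ℝⁿ`. -/
def ddata (n : ℕ) (X : ℂ → Fin n → ℝ) (z : ℂ) : Fin n → ℂ :=
  fun j => wirt (fun w => X w j) z

/-- `X` is a conformal minimal immersion on the open set `O`: it is smooth, its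
derivative data `∂X` is holomorphic on `O`, vanishes nowhere on `O`, and satisfies
`Σⱼ((∂X)ⱼ)² ≡ 0` on `O`. -/
def IsCMI (n : ℕ) (O : Set ℂ) (X : ℂ → Fin n → ℝ) : Prop :=
  ContDiffOn ℝ (⊤ : ℕ∞) X O ∧
  (∀ j, DifferentiableOn ℂ (fun z => ddata n X z j) O) ∧
  (∀ z ∈ O, ddata n X z ≠ 0) ∧
  (∀ z ∈ O, ∑ j, (ddata n X z j) ^ 2 = 0)

/-- `f` extends meromorphically to the point `p`. -/
def MeromAt (f : ℂ → ℂ) (p : ℂ) : Prop :=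
  ∃ (m : ℕ) (g : ℂ → ℂ), AnalyticAt ℂ g p ∧ ∀ᶠ z in 𝓝[≠] p, f z = g z / (z - p) ^ m

/-- `f` has an (effective) pole at `p`. -/
def IsPole (f : ℂ → ℂ) (p : ℂ) : Prop :=
  ∃ m : ℕ, 1 ≤ m ∧ ∃ g : ℂ → ℂ, AnalyticAt ℂ g p ∧ g p ≠ 0 ∧
    ∀ᶠ z in 𝓝[≠] p, f z = g z / (z - p) ^ m

/-- A symmetric bilinear form on an infinite-dimensional complex space has an
infinite-dimensional totally isotropic subspace. -/
theorem exists_isotropic {V : Type*} [AddCommGroup V] [Module ℂ V] (S : Submodule ℂ V)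
    (hS : ¬ FiniteDimensional ℂ S) (B : V →ₗ[ℂ] V →ₗ[ℂ] ℂ) (hB : ∀ x y, B x y = B y x) :
    ∃ S' : Submodule ℂ V, S' ≤ S ∧ ¬ FiniteDimensional ℂ S' ∧ ∀ x ∈ S', ∀ y ∈ S', B x y = 0 := by
  obtain ⟨U, hU⟩ := zorn_le₀ {U : Submodule ℂ V | U ≤ S ∧ ∀ x ∈ U, ∀ y ∈ U, B x y = 0} (by
    intro c hc hch
    rcases c.eq_empty_or_nonempty with rfl | hne
    · exact ⟨⊥, ⟨bot_le, by simp⟩, by simp⟩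
    · refine ⟨sSup c, ⟨sSup_le fun a ha => (hc ha).1, ?_⟩, fun z hz => le_sSup hz⟩
      intro x hx y hy
      rw [Submodule.mem_sSup_of_directed hne hch.directedOn] at hx hy
      obtain ⟨p, hp, hxp⟩ := hx
      obtain ⟨q, hq, hyq⟩ := hy
      rcases hch.total hp hq with h | h
      · exact (hc hq).2 x (h hxp) y hyq
      · exact (hc hp).2 x hxp y (h hyq))
  refine ⟨U, hU.1.1, ?_, hU.1.2⟩
  intro hfin
  -- the orthogonal of `U` inside `S`
  let Φ : S →ₗ[ℂ] (U →ₗ[ℂ] ℂ) := (LinearMap.lcomp ℂ ℂ U.subtype).comp (B.flip.domRestrict S)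
  have hΦ : ∀ (s : S) (u : U), Φ s u = B u s := by
    intro s u; rfl
  have hker : ¬ FiniteDimensional ℂ (LinearMap.ker Φ) := by
    intro h
    apply hS
    have h2 : FiniteDimensional ℂ (S ⧸ LinearMap.ker Φ) :=
      LinearEquiv.finiteDimensional (Φ.quotKerEquivRange).symm
    exact Module.Finite.of_submodule_quotient (LinearMap.ker Φ)
  -- elements outside a finite-dimensional subspace
  have key : ∀ T : Submodule ℂ V, FiniteDimensional ℂ T →
      ∃ v ∈ S, (∀ u ∈ U, B u v = 0) ∧ v ∉ T := by
    intro T hT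
    by_contra hcon
    push Not at hcon
    apply hker
    have : ∀ x : LinearMap.ker Φ, ((S.subtype.comp (LinearMap.ker Φ).subtype) x) ∈ T := by
      rintro ⟨⟨x, hx⟩, hx2⟩
      apply hcon x hx
      intro u hu
      have := LinearMap.congr_fun (LinearMap.mem_ker.1 hx2) ⟨u, hu⟩
      simpa [hΦ] using this
    apply FiniteDimensional.of_injective
      (LinearMap.codRestrict T (S.subtype.comp (LinearMap.ker Φ).subtype) this)
    intro x y hxy
    have := congrArg Subtype.val hxy
    simpa using this
  have ext : ∀ x ∈ S, (∀ u ∈ U, B u x = 0) → B x x = 0 → x ∈ U := by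
    intro x hxS hxU hxx
    have hmem : U ⊔ Submodule.span ℂ {x} ∈
        {U : Submodule ℂ V | U ≤ S ∧ ∀ x ∈ U, ∀ y ∈ U, B x y = 0} := by
      refine ⟨sup_le hU.1.1 (by simpa [Submodule.span_le] using hxS), ?_⟩
      intro a ha b hb
      rw [Submodule.mem_sup] at ha hb
      obtain ⟨a1, ha1, a2, ha2, rfl⟩ := ha
      obtain ⟨b1, hb1, b2, hb2, rfl⟩ := hb
      obtain ⟨c, rfl⟩ := Submodule.mem_span_singleton.1 ha2
      obtain ⟨d, rfl⟩ := Submodule.mem_span_singleton.1 hb2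
      simp [hU.1.2 a1 ha1 b1 hb1, hxU a1 ha1, hxx, hB x b1, hxU b1 hb1]
    have := hU.2 hmem le_sup_left
    exact this (Submodule.mem_sup_right (Submodule.mem_span_singleton_self x))
  obtain ⟨v, hvS, hvU, hv⟩ := key U hfin
  obtain ⟨w, hwS, hwU, hw⟩ := key (U ⊔ Submodule.span ℂ {v}) inferInstance
  have hwU' : w ∉ U := fun h => hw (Submodule.mem_sup_left h)
  have hww : B w w ≠ 0 := fun h => hwU' (ext w hwS hwU h)
  obtain ⟨c, hc⟩ := exists_quadratic_eq_zero (a := B w w) (b := 2 * B v w) (c := B v v) hww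
    (IsAlgClosed.exists_eq_mul_self _)
  have hx : v + c • w ∈ U := by
    apply ext
    · exact S.add_mem hvS (S.smul_mem _ hwS)
    · intro u hu; simp [hvU u hu, hwU u hu]
    · simp [hB w v]; linear_combination hc
  by_cases hc0 : c = 0
  · apply hv; simpa [hc0] using hx
  · apply hw
    have : w = c⁻¹ • (v + c • w) - c⁻¹ • v := by
      rw [smul_add, smul_smul, inv_mul_cancel₀ hc0]; simp
    rw [this]
    exact Submodule.sub_mem _ (Submodule.mem_sup_left (U.smul_mem _ hx))
      (Submodule.mem_sup_right (Submodule.smul_mem _ _ (Submodule.mem_span_singleton_self v)))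

theorem exists_isotropic_finset {V ι : Type*} [AddCommGroup V] [Module ℂ V] (s : Finset ι)
    (B : ι → V →ₗ[ℂ] V →ₗ[ℂ] ℂ) (hB : ∀ i x y, B i x y = B i y x) (S : Submodule ℂ V)
    (hS : ¬ FiniteDimensional ℂ S) :
    ∃ S' : Submodule ℂ V, S' ≤ S ∧ ¬ FiniteDimensional ℂ S' ∧
      ∀ i ∈ s, ∀ x ∈ S', ∀ y ∈ S', B i x y = 0 := by
  classical
  induction s using Finset.induction_on with
  | empty => exact ⟨S, le_rfl, hS, by simp⟩
  | insert a s ha ih =>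
    obtain ⟨S1, h1, h2, h3⟩ := ih
    obtain ⟨S2, k1, k2, k3⟩ := exists_isotropic S1 h2 (B a) (hB a)
    refine ⟨S2, k1.trans h1, k2, ?_⟩
    intro i hi x hx y hy
    rcases Finset.mem_insert.1 hi with rfl | hi
    · exact k3 x hx y hy
    · exact h3 i hi x (k1 hx) y (k1 hy)

theorem ker_not_finite {V M : Type*} [AddCommGroup V] [Module ℂ V] [AddCommGroup M] [Module ℂ M]
    [FiniteDimensional ℂ M] (hV : ¬ FiniteDimensional ℂ V) (L : V →ₗ[ℂ] M) :
    ¬ FiniteDimensional ℂ (LinearMap.ker L) := by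
  intro h
  apply hV
  have h2 : FiniteDimensional ℂ (V ⧸ LinearMap.ker L) :=
    LinearEquiv.finiteDimensional (L.quotKerEquivRange).symm
  exact Module.Finite.of_submodule_quotient (LinearMap.ker L)

theorem rank_drop {H G : Type*} [AddCommGroup H] [Module ℂ H] [FiniteDimensional ℂ H]
    [AddCommGroup G] [Module ℂ G] (A E1 E2 : H →ₗ[ℂ] G) (v : H) (hv : A v = 0)
    (hv1 : E1 v ∉ LinearMap.range A) :
    ∀ᶠ t : ℂ in 𝓝[≠] 0, Module.finrank ℂ (LinearMap.ker (A + t • E1 + t ^ 2 • E2)) <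
      Module.finrank ℂ (LinearMap.ker A) := by
  obtain ⟨H', hH'⟩ := Submodule.exists_isCompl (LinearMap.ker A)
  let C0 : (H' × ℂ) →ₗ[ℂ] G :=
    (A.comp H'.subtype).coprod (LinearMap.toSpanSingleton ℂ G (E1 v))
  let C1 : (H' × ℂ) →ₗ[ℂ] G :=
    (E1.comp H'.subtype).coprod (LinearMap.toSpanSingleton ℂ G (E2 v))
  let C2 : (H' × ℂ) →ₗ[ℂ] G := (E2.comp H'.subtype).coprod 0
  have hC0 : LinearMap.ker C0 = ⊥ := by
    rw [LinearMap.ker_eq_bot']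
    rintro ⟨h, c⟩ hh
    have e : A h + c • E1 v = 0 := by simpa [C0] using hh
    have hc : c = 0 := by
      by_contra hc
      apply hv1
      refine ⟨-(c⁻¹ • (h : H)), ?_⟩
      rw [map_neg, map_smul, eq_neg_of_add_eq_zero_left e]
      simp [smul_smul, inv_mul_cancel₀ hc]
    subst hc
    have : (h : H) ∈ LinearMap.ker A ⊓ H' := ⟨by simpa using e, h.2⟩
    rw [hH'.inf_eq_bot] at this
    simpa using this
  obtain ⟨L, hL⟩ := C0.exists_leftInverse_of_injective hC0
  let b := Module.finBasis ℂ (H' × ℂ)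
  have hdet : ∀ᶠ t : ℂ in 𝓝 0, (LinearMap.toMatrix b b (L.comp C0) +
      t • LinearMap.toMatrix b b (L.comp C1) + t ^ 2 • LinearMap.toMatrix b b (L.comp C2)).det ≠ 0 := by
    apply ContinuousAt.eventually_ne
    · apply Continuous.continuousAt
      apply Continuous.matrix_det
      fun_prop
    · rw [hL]; simp
  filter_upwards [hdet.filter_mono nhdsWithin_le_nhds, self_mem_nhdsWithin] with t ht ht0
  have ht0 : t ≠ 0 := ht0
  rw [← map_smul, ← map_smul, ← map_add, ← map_add, LinearMap.det_toMatrix] at ht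
  have hinj : Function.Injective (L.comp C0 + t • L.comp C1 + t ^ 2 • L.comp C2) := by
    rw [← LinearMap.ker_eq_bot]
    by_contra hk
    exact ht (LinearMap.det_eq_zero_iff_ker_ne_bot.2 hk)
  let J : (H' × ℂ) →ₗ[ℂ] H := H'.subtype.coprod (LinearMap.toSpanSingleton ℂ H (t⁻¹ • v))
  have hJ : Function.Injective ((A + t • E1 + t ^ 2 • E2).comp J) := by
    have : L.comp C0 + t • L.comp C1 + t ^ 2 • L.comp C2 =
        L.comp ((A + t • E1 + t ^ 2 • E2).comp J) := by
      rw [← LinearMap.comp_smul, ← LinearMap.comp_smul, ← LinearMap.comp_add, ← LinearMap.comp_add]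
      congr 1
      ext x
      · simp [C0, C1, C2, J]
      · simp [C0, C1, C2, J, hv, smul_smul, ht0, pow_two]
    rw [this] at hinj
    exact Function.Injective.of_comp (f := L) hinj
  have h1 : Module.finrank ℂ (H' × ℂ) ≤
      Module.finrank ℂ (LinearMap.range (A + t • E1 + t ^ 2 • E2)) := by
    rw [← LinearMap.finrank_range_of_inj hJ]
    exact Submodule.finrank_mono (LinearMap.range_comp_le_range _ _)
  have h2 := (A + t • E1 + t ^ 2 • E2).finrank_range_add_finrank_ker
  have h3 := Submodule.finrank_add_eq_of_isCompl hH'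
  have h4 : Module.finrank ℂ (H' × ℂ) = Module.finrank ℂ H' + 1 := by simp
  omega

/-- Holomorphic functions on `D`. -/
def holSub (D : Set ℂ) : Submodule ℂ (ℂ → ℂ) where
  carrier := {f | DifferentiableOn ℂ f D}
  add_mem' := fun hf hg => DifferentiableOn.add hf hg
  zero_mem' := differentiableOn_const 0
  smul_mem' := fun c _ hf => DifferentiableOn.const_smul hf c

theorem prim_unique {c : ℂ} {ρ : ℝ} (hρ : 0 < ρ) {F G φ : ℂ → ℂ}
    (hF : ∀ z ∈ Metric.ball c ρ, HasDerivAt F (φ z) z)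
    (hG : ∀ z ∈ Metric.ball c ρ, HasDerivAt G (φ z) z) (h : F c = G c) :
    ∀ z ∈ Metric.ball c ρ, F z = G z := by
  intro z hz
  refine Metric.isOpen_ball.eqOn_of_deriv_eq (convex_ball c ρ).isPreconnected
    (fun z hz => (hF z hz).differentiableAt.differentiableWithinAt)
    (fun z hz => (hG z hz).differentiableAt.differentiableWithinAt) ?_
    (Metric.mem_ball_self hρ) h hz
  intro z hz
  rw [(hF z hz).deriv, (hG z hz).deriv]

/-- Evaluation at `z` of the primitive vanishing at the centre of a disc. -/
theorem exists_primEval (D : Set ℂ) (c : ℂ) (ρ : ℝ) (hρ : 0 < ρ) (hD : Metric.ball c ρ ⊆ D) :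
    ∃ P : ℂ → (holSub D →ₗ[ℂ] ℂ), ∀ φ : holSub D, P c φ = 0 ∧
      ∀ z ∈ Metric.ball c ρ, HasDerivAt (fun w => P w φ) (φ.1 z) z := by
  classical
  have hex : ∀ φ : holSub D, ∃ F : ℂ → ℂ, F c = 0 ∧
      ∀ z ∈ Metric.ball c ρ, HasDerivAt F (φ.1 z) z := fun φ =>
    (DifferentiableOn.isExactOn_ball (DifferentiableOn.mono φ.2 hD)).with_val_at c 0
  choose F hF0 hF using hex
  refine ⟨fun z =>
    { toFun := fun φ => if z ∈ Metric.ball c ρ then F φ z else 0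
      map_add' := ?_
      map_smul' := ?_ }, ?_⟩
  · intro φ ψ
    split_ifs with hz
    · refine prim_unique hρ (hF (φ + ψ)) (G := fun z => F φ z + F ψ z) ?_ ?_ z hz
      · intro z hz
        exact (hF φ z hz).add (hF ψ z hz)
      · simp [hF0]
    · simp
  · intro a φ
    split_ifs with hz
    · refine prim_unique hρ (hF (a • φ)) (G := fun z => a * F φ z) ?_ ?_ z hz
      · intro z hz
        exact (hF φ z hz).const_mul a
      · simp [hF0]
    · simp
  · intro φ
    refine ⟨by simp [hF0], ?_⟩
    intro z hz
    apply (hF φ z hz).congr_of_eventuallyEq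
    filter_upwards [Metric.isOpen_ball.mem_nhds hz] with w hw
    simp [Metric.mem_ball.1 hw]

/-- Finitely many linear conditions guarantee a primitive on a finite union of discs
vanishing at all the centres. -/
theorem exists_period (C : Finset ℂ) (ρ : ℂ → ℝ) (hρ : ∀ c, 0 < ρ c) (D : Set ℂ)
    (hD : D = ⋃ c ∈ C, Metric.ball c (ρ c)) :
    ∃ T : holSub D →ₗ[ℂ] (C × C → ℂ), ∀ φ : holSub D, T φ = 0 →
      ∃ F : ℂ → ℂ, (∀ z ∈ D, HasDerivAt F (φ.1 z) z) ∧ ∀ c ∈ C, F c = 0 := by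
  classical
  have hsub : ∀ c : C, Metric.ball c.1 (ρ c) ⊆ D := by
    intro c; rw [hD]; exact Set.subset_biUnion_of_mem (u := fun c => Metric.ball c (ρ c)) c.2
  choose P hP using fun c : C => exists_primEval D c.1 (ρ c) (hρ c) (hsub c)
  let x : C × C → ℂ := fun p =>
    if h : (Metric.ball p.1.1 (ρ p.1) ∩ Metric.ball p.2.1 (ρ p.2)).Nonempty then h.some else 0
  refine ⟨LinearMap.pi fun p => P p.1 (x p) - P p.2 (x p), ?_⟩
  intro φ hφ
  have hagree : ∀ c c' : C, ∀ z ∈ Metric.ball c.1 (ρ c) ∩ Metric.ball c'.1 (ρ c'),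
      P c z φ = P c' z φ := by
    intro c c' z hz
    have hne : (Metric.ball c.1 (ρ c) ∩ Metric.ball c'.1 (ρ c')).Nonempty := ⟨z, hz⟩
    have hx : x (c, c') ∈ Metric.ball c.1 (ρ c) ∩ Metric.ball c'.1 (ρ c') := by
      simp only [x]
      rw [dif_pos hne]
      exact hne.some_mem
    have heq : P c (x (c, c')) φ = P c' (x (c, c')) φ := by
      have := congrFun hφ (c, c')
      simpa [sub_eq_zero] using this
    refine (Metric.isOpen_ball.inter Metric.isOpen_ball).eqOn_of_deriv_eq
      (f := fun w => P c w φ) (g := fun w => P c' w φ)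
      ((convex_ball _ _).inter (convex_ball _ _)).isPreconnected
      (fun z hz => ((hP c φ).2 z hz.1).differentiableAt.differentiableWithinAt)
      (fun z hz => ((hP c' φ).2 z hz.2).differentiableAt.differentiableWithinAt) ?_
      hx heq hz
    intro z hz
    rw [((hP c φ).2 z hz.1).deriv, ((hP c' φ).2 z hz.2).deriv]
  let F : ℂ → ℂ := fun z =>
    if h : ∃ c : C, z ∈ Metric.ball c.1 (ρ c) then P h.choose z φ else 0
  have hF : ∀ c : C, ∀ z ∈ Metric.ball c.1 (ρ c), F z = P c z φ := by
    intro c z hz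
    have h : ∃ c : C, z ∈ Metric.ball c.1 (ρ c) := ⟨c, hz⟩
    simp only [F]
    rw [dif_pos h]
    exact hagree _ _ z ⟨h.choose_spec, hz⟩
  refine ⟨F, ?_, ?_⟩
  · intro z hz
    rw [hD] at hz
    simp only [Set.mem_iUnion] at hz
    obtain ⟨c, hc, hz⟩ := hz
    apply ((hP ⟨c, hc⟩ φ).2 z hz).congr_of_eventuallyEq
    filter_upwards [Metric.isOpen_ball.mem_nhds hz] with w hw
    exact hF ⟨c, hc⟩ w hw
  · intro c hc
    rw [hF ⟨c, hc⟩ c (Metric.mem_ball_self (hρ c))]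
    exact (hP ⟨c, hc⟩ φ).1

/-- Multiplication of a holomorphic function by a polynomial. -/
def mulPoly (D : Set ℂ) (u : holSub D) : Polynomial ℂ →ₗ[ℂ] holSub D where
  toFun := fun q => ⟨fun z => q.eval z * u.1 z, q.differentiable.differentiableOn.mul u.2⟩
  map_add' := by intro p q; ext z; simp [add_mul]
  map_smul' := by intro a q; ext z; simp [mul_assoc]

theorem poly_not_finite : ¬ FiniteDimensional ℂ (Polynomial ℂ) := Polynomial.not_finite

theorem exists_poly_space (C : Finset ℂ) (ρ : ℂ → ℝ) (hρ : ∀ c, 0 < ρ c) (D : Set ℂ)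
    (hD : D = ⋃ c ∈ C, Metric.ball c (ρ c)) (u v w : ℂ → ℂ) (hu : DifferentiableOn ℂ u D)
    (hv : DifferentiableOn ℂ v D) (hw : DifferentiableOn ℂ w D) :
    ∃ S : Submodule ℂ (Polynomial ℂ), ¬ FiniteDimensional ℂ S ∧ ∀ q ∈ S,
      (∃ F : ℂ → ℂ, (∀ z ∈ D, HasDerivAt F (q.eval z * u z) z) ∧ ∀ c ∈ C, F c = 0) ∧
      (∃ F : ℂ → ℂ, (∀ z ∈ D, HasDerivAt F (q.eval z * v z) z) ∧ ∀ c ∈ C, F c = 0) ∧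
      (∃ F : ℂ → ℂ, (∀ z ∈ D, HasDerivAt F (q.eval z ^ 2 * w z) z) ∧ ∀ c ∈ C, F c = 0) := by
  obtain ⟨T, hT⟩ := exists_period C ρ hρ D hD
  let L := (T.comp (mulPoly D ⟨u, hu⟩)).prod (T.comp (mulPoly D ⟨v, hv⟩))
  let B : C × C → Polynomial ℂ →ₗ[ℂ] Polynomial ℂ →ₗ[ℂ] ℂ := fun i =>
    (LinearMap.mul ℂ (Polynomial ℂ)).compr₂ ((LinearMap.proj i).comp (T.comp (mulPoly D ⟨w, hw⟩)))
  obtain ⟨S, hS1, hS2, hS3⟩ := exists_isotropic_finset Finset.univ B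
    (by intro i x y; simp [B, mul_comm]) (LinearMap.ker L)
    (ker_not_finite Polynomial.not_finite L)
  refine ⟨S, hS2, fun q hq => ?_⟩
  have hL : T (mulPoly D ⟨u, hu⟩ q) = 0 ∧ T (mulPoly D ⟨v, hv⟩ q) = 0 := by
    simpa [L] using hS1 hq
  have hQ : T (mulPoly D ⟨w, hw⟩ (q * q)) = 0 := by
    ext i
    exact hS3 i (Finset.mem_univ _) q hq q hq
  refine ⟨hT _ hL.1, hT _ hL.2, ?_⟩
  obtain ⟨F, hF, hF0⟩ := hT _ hQ
  refine ⟨F, fun z hz => ?_, hF0⟩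
  have := hF z hz
  simpa [mulPoly, pow_two] using this

open Matrix in
theorem exists_direction (n : ℕ) (hn : 3 ≤ n) (α w : Fin n → ℂ) (j k : Fin n)
    (h : α j * w k - α k * w j ≠ 0) :
    ∃ a b : Fin n → ℂ, a ⬝ᵥ a = 0 ∧ a ⬝ᵥ b = 0 ∧ b ⬝ᵥ b = 1 ∧
      (α ⬝ᵥ a) * (b ⬝ᵥ w) - (α ⬝ᵥ b) * (a ⬝ᵥ w) ≠ 0 := by
  have hjk : j ≠ k := by rintro rfl; apply h; ring
  obtain ⟨l, hlj, hlk⟩ : ∃ l : Fin n, l ≠ j ∧ l ≠ k := by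
    by_contra hcon
    push Not at hcon
    have : (Finset.univ : Finset (Fin n)) ⊆ {j, k} := by
      intro l _
      by_cases hl : l = j
      · simp [hl]
      · simp [hcon l hl]
    have := Finset.card_le_card this
    have h2 := Finset.card_le_two (a := j) (b := k)
    simp at this
    omega
  by_contra hcon
  push Not at hcon
  have key : ∀ σ : ℂ, σ ^ 2 = -1 →
      (α j + α l * σ) * w k - α k * (w j + σ * w l) = 0 := by
    intro σ hσ
    have := hcon (Pi.single j 1 + Pi.single l σ) (Pi.single k 1)
      (by simp [hlj, hlj.symm]; linear_combination hσ)
      (by simp [hjk.symm, hlk.symm]) (by simp)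
    simpa [dotProduct_add, add_dotProduct] using this
  have h1 := key I (by simp)
  have h2 := key (-I) (by simp)
  apply h
  linear_combination h1 / 2 + h2 / 2

/-- Linear combinations of the components of `φ`, as functions on `U`. -/
def Ev0 {n : ℕ} (U : Set ℂ) (φ : ℂ → Fin n → ℂ) : ((Fin n → ℂ) × ℂ) →ₗ[ℂ] (U → ℂ) where
  toFun := fun x z => ∑ j, x.1 j * φ z j
  map_add' := by intro x y; ext z; simp [add_mul, Finset.sum_add_distrib]
  map_smul' := by intro a x; ext z; simp [Finset.mul_sum, mul_assoc]

/-- Affine combinations of the components of `g`, as functions on `U`. -/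
def Ev {n : ℕ} (U : Set ℂ) (g : ℂ → Fin n → ℂ) : ((Fin n → ℂ) × ℂ) →ₗ[ℂ] (U → ℂ) where
  toFun := fun x z => ∑ j, x.1 j * g z j - x.2
  map_add' := by intro x y; ext z; simp [add_mul, Finset.sum_add_distrib]; ring
  map_smul' := by intro a x; ext z; simp [Finset.mul_sum, mul_assoc, mul_sub]

theorem mem_ker_Ev {n : ℕ} {U : Set ℂ} {g : ℂ → Fin n → ℂ} {x : (Fin n → ℂ) × ℂ} :
    x ∈ LinearMap.ker (Ev U g) ↔ ∀ z ∈ U, ∑ j, x.1 j * g z j = x.2 := by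
  rw [LinearMap.mem_ker]
  constructor
  · intro h z hz
    have := congrFun h ⟨z, hz⟩
    simpa [Ev, sub_eq_zero] using this
  · intro h
    ext ⟨z, hz⟩
    simpa [Ev, sub_eq_zero] using h z hz

theorem exists_nonparallel (n : ℕ) (hn : 3 ≤ n) (U : Set ℂ) (hU : U.Nonempty)
    (g : ℂ → Fin n → ℂ) (hnz : ∀ z ∈ U, g z ≠ 0) (hnull : ∀ z ∈ U, ∑ j, g z j ^ 2 = 0)
    (hker : LinearMap.ker (Ev U g) ≠ ⊥) :
    ∃ x ∈ LinearMap.ker (Ev U g), ∃ z ∈ U, ∃ j k, x.1 j * g z k - x.1 k * g z j ≠ 0 := by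
  obtain ⟨z₀, hz₀⟩ := hU
  by_contra hcon
  push Not at hcon
  obtain ⟨x, hx, hx0⟩ := (Submodule.ne_bot_iff _).1 hker
  have hα : x.1 ≠ 0 := by
    intro h
    apply hx0
    have := mem_ker_Ev.1 hx z₀ hz₀
    simp [h] at this
    exact Prod.ext h this.symm
  obtain ⟨i, hi⟩ := Function.ne_iff.1 hα
  simp only [Pi.zero_apply] at hi
  -- `g z` is a multiple of `x.1`
  have hpar : ∀ z ∈ U, ∀ k, g z k = g z i / x.1 i * x.1 k := by
    intro z hz k
    have := hcon x hx z hz i k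
    field_simp
    linear_combination this
  have hη : ∀ z ∈ U, g z i ≠ 0 := by
    intro z hz h
    apply hnz z hz
    ext k
    rw [hpar z hz k, h]; simp
  have hzero : ∀ l, l ≠ i → g z₀ l = 0 := by
    intro l hl
    obtain ⟨k, hki, hkl⟩ : ∃ k : Fin n, k ≠ i ∧ k ≠ l := by
      by_contra hcon
      push Not at hcon
      have : (Finset.univ : Finset (Fin n)) ⊆ {i, l} := by
        intro k _
        by_cases hk : k = i
        · simp [hk]
        · simp [hcon k hk]
      have := Finset.card_le_card this
      have h2 := Finset.card_le_two (a := i) (b := l)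
      simp at this
      omega
    have hy : ((Pi.single i (x.1 k) - Pi.single k (x.1 i), 0) : (Fin n → ℂ) × ℂ) ∈
        LinearMap.ker (Ev U g) := by
      rw [mem_ker_Ev]
      intro z hz
      have := hpar z hz k
      simp [sub_mul, Finset.sum_sub_distrib, Pi.single_apply]
      rw [this]; field_simp; ring
    have := hcon _ hy z₀ hz₀ k l
    simp [hki, hkl.symm, hl] at this
    rcases this with h | h
    · exact absurd h hi
    · exact h
  have h1 := hnull z₀ hz₀
  rw [Finset.sum_eq_single i (fun l _ hl => by simp [hzero l hl]) (by simp)] at h1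
  exact hη z₀ hz₀ (by simpa using h1)

theorem bigO_prim {F φ : ℂ → ℂ} {p : ℂ} {r : ℕ} (hF : ∀ᶠ z in 𝓝 p, HasDerivAt F (φ z) z)
    (hp : F p = 0) (hφ : φ =O[𝓝 p] fun z => (z - p) ^ r) : F =O[𝓝 p] fun z => (z - p) ^ r := by
  obtain ⟨c, hc, hcφ⟩ := hφ.exists_pos
  rw [Asymptotics.isBigOWith_iff] at hcφ
  obtain ⟨δ, hδ, hball⟩ := Metric.eventually_nhds_iff_ball.1 (hF.and hcφ)
  apply Asymptotics.IsBigO.of_bound c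
  have hδ1 : 0 < min δ 1 := lt_min hδ one_pos
  filter_upwards [Metric.ball_mem_nhds p hδ1] with z hz
  have hzd : ‖z - p‖ < min δ 1 := by simpa [dist_eq_norm] using hz
  have hsub : ∀ w ∈ Metric.closedBall p ‖z - p‖, w ∈ Metric.ball p δ := by
    intro w hw
    have : dist w p ≤ ‖z - p‖ := hw
    exact lt_of_le_of_lt this (hzd.trans_le (min_le_left _ _))
  have := (convex_closedBall p ‖z - p‖).norm_image_sub_le_of_norm_hasDerivWithin_le (f := F)
    (f' := φ) (C := c * ‖z - p‖ ^ r)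
    (fun w hw => ((hball w (hsub w hw)).1).hasDerivWithinAt)
    (fun w hw => by
      refine ((hball w (hsub w hw)).2).trans ?_
      rw [norm_pow]
      have : ‖w - p‖ ≤ ‖z - p‖ := by simpa [dist_eq_norm] using hw
      gcongr)
    (Metric.mem_closedBall_self (norm_nonneg _)) (show z ∈ _ by simp [dist_eq_norm])
  rw [hp, sub_zero] at this
  rw [norm_pow]
  refine this.trans ?_
  have h1 : ‖z - p‖ ≤ 1 := (hzd.trans_le (min_le_right _ _)).le
  exact mul_le_of_le_one_right (by positivity) h1

/-- The polynomial vanishing simply on the finite set `Q`. -/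
def Pt (Q : Finset ℂ) (z : ℂ) : ℂ := ∏ p ∈ Q, (z - p)

theorem Pt_diff (Q : Finset ℂ) : Differentiable ℂ (Pt Q) := by
  unfold Pt; fun_prop

theorem Pt_bigO (Q : Finset ℂ) (r : ℕ) (h : ℂ → ℂ) (p : ℂ) (hp : p ∈ Q) (hh : ContinuousAt h p) :
    (fun z => Pt Q z ^ r * h z) =O[𝓝 p] fun z => (z - p) ^ r := by
  have e : (fun z => Pt Q z ^ r * h z) =
      fun z => (z - p) ^ r * ((∏ x ∈ Q.erase p, (z - x)) ^ r * h z) := by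
    ext z
    rw [Pt, ← Finset.mul_prod_erase Q _ hp, mul_pow, mul_assoc]
  rw [e]
  have hc : ContinuousAt (fun z => (∏ x ∈ Q.erase p, (z - x)) ^ r * h z) p := by fun_prop
  simpa using (Asymptotics.isBigO_refl (fun z : ℂ => (z - p) ^ r) (𝓝 p)).mul (hc.isBigO_one ℂ)

open Matrix in
theorem null_move {n : ℕ} (a b w : Fin n → ℂ) (haa : a ⬝ᵥ a = 0) (hab : a ⬝ᵥ b = 0)
    (hbb : b ⬝ᵥ b = 1) (hw : w ⬝ᵥ w = 0) (hw0 : w ≠ 0) (s : ℂ) (y : Fin n → ℂ)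
    (hy : y = w + (s * (b ⬝ᵥ w)) • a - (s * (a ⬝ᵥ w)) • b - (s ^ 2 / 2 * (a ⬝ᵥ w)) • a) :
    y ≠ 0 ∧ y ⬝ᵥ y = 0 := by
  have hba : b ⬝ᵥ a = 0 := by rw [dotProduct_comm, hab]
  constructor
  · intro h0
    have h1 : a ⬝ᵥ y = a ⬝ᵥ w := by
      rw [hy]; simp [dotProduct_sub, dotProduct_add, haa, hab]
    have h2 : b ⬝ᵥ y = b ⬝ᵥ w - s * (a ⬝ᵥ w) := by
      rw [hy]; simp [dotProduct_sub, dotProduct_add, hba, hbb]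
    rw [h0, dotProduct_zero] at h1 h2
    rw [← h1] at h2
    have h3 : b ⬝ᵥ w = 0 := by simpa using h2.symm
    rw [h0, ← h1, h3] at hy
    apply hw0
    simpa using hy.symm
  · rw [hy]
    simp only [dotProduct_sub, dotProduct_add, sub_dotProduct, add_dotProduct, dotProduct_smul,
      smul_dotProduct, haa, hab, hba, hbb, hw, smul_eq_mul, dotProduct_comm w a,
      dotProduct_comm w b]
    ring

open Matrix in
theorem exists_step (n : ℕ) (hn : 3 ≤ n) (C : Finset ℂ) (ρ : ℂ → ℝ) (hρ : ∀ c, 0 < ρ c)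
    (D : Set ℂ) (hD : D = ⋃ c ∈ C, Metric.ball c (ρ c)) (hDo : IsOpen D)
    (Q : Finset ℂ) (hQC : Q ⊆ C)
    (U : Set ℂ) (hU : IsOpen U) (hUD : U ⊆ D) (hUne : U.Nonempty)
    (g : ℂ → Fin n → ℂ) (M r : ℕ) (hM : ∀ j, DifferentiableOn ℂ (fun z => Pt Q z ^ M * g z j) D)
    (hgc : ∀ j, ContinuousOn (fun z => g z j) U)
    (hnz : ∀ z ∈ U, g z ≠ 0) (hnull : ∀ z ∈ U, ∑ j, g z j ^ 2 = 0)
    (hker : LinearMap.ker (Ev U g) ≠ ⊥) :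
    ∃ F1 F2 : ℂ → Fin n → ℂ,
      (∀ j, DifferentiableOn ℂ (fun z => F1 z j) D) ∧
      (∀ j, DifferentiableOn ℂ (fun z => F2 z j) D) ∧
      (∀ p ∈ Q, ∀ j, (fun z => F1 z j) =O[𝓝 p] fun z => (z - p) ^ r) ∧
      (∀ p ∈ Q, ∀ j, (fun z => F2 z j) =O[𝓝 p] fun z => (z - p) ^ r) ∧
      (∀ t : ℂ, ∀ z ∈ U, (fun j => g z j + t * deriv (fun w => F1 w j) z +
          t ^ 2 * deriv (fun w => F2 w j) z) ≠ 0 ∧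
        ∑ j, (g z j + t * deriv (fun w => F1 w j) z + t ^ 2 * deriv (fun w => F2 w j) z) ^ 2 = 0) ∧
      ∀ᶠ t : ℂ in 𝓝[≠] 0, Module.finrank ℂ (LinearMap.ker (Ev U (fun z j => g z j +
          t * deriv (fun w => F1 w j) z + t ^ 2 * deriv (fun w => F2 w j) z))) <
        Module.finrank ℂ (LinearMap.ker (Ev U g)) := by
  classical
  obtain ⟨x, hx, z₀, hz₀, j, k, hjk⟩ := exists_nonparallel n hn U hUne g hnz hnull hker
  obtain ⟨a, b, haa, hab, hbb, hκ⟩ := exists_direction n hn x.1 (g z₀) j k hjk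
  have hdot : ∀ y : Fin n → ℂ, DifferentiableOn ℂ (fun z => Pt Q z ^ M * (y ⬝ᵥ g z)) D := by
    intro y
    have : (fun z => Pt Q z ^ M * (y ⬝ᵥ g z)) = fun z => ∑ j, y j * (Pt Q z ^ M * g z j) := by
      ext z
      simp only [dotProduct, Finset.mul_sum]
      exact Finset.sum_congr rfl fun j _ => by ring
    rw [this]
    exact DifferentiableOn.fun_sum fun j _ => (hM j).const_mul _
  have hPt := Pt_diff Q
  obtain ⟨S, hS, hSq⟩ := exists_poly_space C ρ hρ D hD
    (fun z => Pt Q z ^ r * (Pt Q z ^ M * (b ⬝ᵥ g z)))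
    (fun z => Pt Q z ^ r * (Pt Q z ^ M * (a ⬝ᵥ g z)))
    (fun z => Pt Q z ^ (M + 2 * r) * (Pt Q z ^ M * (a ⬝ᵥ g z)))
    ((hPt.pow r).differentiableOn.mul (hdot b)) ((hPt.pow r).differentiableOn.mul (hdot a))
    ((hPt.pow _).differentiableOn.mul (hdot a))
  -- the first order variation of the relation `x`
  let κ : ℂ → ℂ := fun z => (x.1 ⬝ᵥ a) * (b ⬝ᵥ g z) - (x.1 ⬝ᵥ b) * (a ⬝ᵥ g z)
  have hκc : ContinuousOn κ U := by
    have : ∀ y : Fin n → ℂ, ContinuousOn (fun z => y ⬝ᵥ g z) U := fun y =>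
      continuousOn_finsetSum _ fun j _ => (hgc j).const_mul _
    exact ((this b).const_mul _).sub ((this a).const_mul _)
  let Ψ : Polynomial ℂ →ₗ[ℂ] (U → ℂ) :=
    { toFun := fun q z => Pt Q z ^ (M + r) * q.eval z.1 * κ z
      map_add' := by intro p q; ext z; simp; ring
      map_smul' := by intro c q; ext z; simp; ring }
  have hΨ : Function.Injective Ψ := by
    rw [← LinearMap.ker_eq_bot, LinearMap.ker_eq_bot']
    intro q hq
    apply Polynomial.eq_zero_of_infinite_isRoot
    have h1 : ∀ᶠ z in 𝓝 z₀, z ∈ U ∧ κ z ≠ 0 :=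
      (hU.eventually_mem hz₀).and ((hκc.continuousAt (hU.mem_nhds hz₀)).eventually_ne hκ)
    have h2 : ({z | z ∈ U ∧ κ z ≠ 0} \ (Q : Set ℂ)).Infinite :=
      (infinite_of_mem_nhds z₀ h1).sdiff Q.finite_toSet
    apply h2.mono
    rintro z ⟨⟨hzU, hzκ⟩, hzQ⟩
    have hP : Pt Q z ≠ 0 := by
      rw [Pt, Finset.prod_ne_zero_iff]
      intro p hp h
      apply hzQ
      rw [sub_eq_zero.1 h]
      exact hp
    have := congrFun hq ⟨z, hzU⟩
    simpa [Ψ, hP, hzκ] using this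
  obtain ⟨q, hqS, hq⟩ : ∃ q ∈ S, Ψ q ∉ LinearMap.range (Ev U g) := by
    by_contra hcon
    push Not at hcon
    apply hS
    apply FiniteDimensional.of_injective (LinearMap.codRestrict (LinearMap.range (Ev U g))
      (Ψ.comp S.subtype) (fun y => hcon y y.2))
    intro y y' hyy
    have h1 := congrArg Subtype.val hyy
    exact Subtype.ext (hΨ h1)
  obtain ⟨⟨Fu, hFu, hFu0⟩, ⟨Fv, hFv, hFv0⟩, ⟨Fw, hFw, hFw0⟩⟩ := hSq q hqS
  have hd1 : ∀ j, ∀ z ∈ D, HasDerivAt (fun z => a j * Fu z - b j * Fv z)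
      (a j * (q.eval z * (Pt Q z ^ r * (Pt Q z ^ M * (b ⬝ᵥ g z)))) -
        b j * (q.eval z * (Pt Q z ^ r * (Pt Q z ^ M * (a ⬝ᵥ g z))))) z := fun j z hz =>
    ((hFu z hz).const_mul _).sub ((hFv z hz).const_mul _)
  have hd2 : ∀ j, ∀ z ∈ D, HasDerivAt (fun z => (-(1 / 2) * a j) * Fw z)
      ((-(1 / 2) * a j) * (q.eval z ^ 2 * (Pt Q z ^ (M + 2 * r) * (Pt Q z ^ M * (a ⬝ᵥ g z))))) z :=
    fun j z hz => (hFw z hz).const_mul _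
  have hQD : ∀ p ∈ Q, D ∈ 𝓝 p := by
    intro p hp
    apply hDo.mem_nhds
    rw [hD]
    simp only [Set.mem_iUnion]
    exact ⟨p, hQC hp, Metric.mem_ball_self (hρ p)⟩
  have hO : ∀ p ∈ Q, ∀ (F ψ : ℂ → ℂ), (∀ z ∈ D, HasDerivAt F (Pt Q z ^ r * ψ z) z) → F p = 0 →
      ContinuousAt ψ p → F =O[𝓝 p] fun z => (z - p) ^ r := by
    intro p hp F ψ hF hF0 hψ
    refine bigO_prim (φ := fun z => Pt Q z ^ r * ψ z) ?_ hF0 (Pt_bigO Q r ψ p hp hψ)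
    filter_upwards [hQD p hp] with z hz using hF z hz
  have hqc : Continuous fun z => q.eval z := q.continuous
  have hdc : ∀ y : Fin n → ℂ, ∀ p ∈ Q, ContinuousAt (fun z => Pt Q z ^ M * (y ⬝ᵥ g z)) p :=
    fun y p hp => (hdot y).continuousOn.continuousAt (hQD p hp)
  have hOu : ∀ p ∈ Q, Fu =O[𝓝 p] fun z => (z - p) ^ r := by
    intro p hp
    refine hO p hp Fu (fun z => q.eval z * (Pt Q z ^ M * (b ⬝ᵥ g z))) ?_ (hFu0 p (hQC hp))
      (hqc.continuousAt.mul (hdc b p hp))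
    intro z hz
    convert hFu z hz using 1; ring
  have hOv : ∀ p ∈ Q, Fv =O[𝓝 p] fun z => (z - p) ^ r := by
    intro p hp
    refine hO p hp Fv (fun z => q.eval z * (Pt Q z ^ M * (a ⬝ᵥ g z))) ?_ (hFv0 p (hQC hp))
      (hqc.continuousAt.mul (hdc a p hp))
    intro z hz
    convert hFv z hz using 1; ring
  have hOw : ∀ p ∈ Q, Fw =O[𝓝 p] fun z => (z - p) ^ r := by
    intro p hp
    refine hO p hp Fw (fun z => (q.eval z ^ 2 * Pt Q z ^ (M + r)) * (Pt Q z ^ M * (a ⬝ᵥ g z))) ?_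
      (hFw0 p (hQC hp)) (ContinuousAt.mul ?_ (hdc a p hp))
    · intro z hz
      convert hFw z hz using 1; ring
    · have := hPt.continuous
      fun_prop
  refine ⟨fun z j => a j * Fu z - b j * Fv z, fun z j => (-(1 / 2) * a j) * Fw z,
    fun j z hz => (hd1 j z hz).differentiableAt.differentiableWithinAt,
    fun j z hz => (hd2 j z hz).differentiableAt.differentiableWithinAt,
    fun p hp j => ((hOu p hp).const_mul_left _).sub ((hOv p hp).const_mul_left _),
    fun p hp j => (hOw p hp).const_mul_left _, ?_, ?_⟩
  · intro t z hz
    have := null_move a b (g z) haa hab hbb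
      (by rw [← hnull z hz]; simp [dotProduct, pow_two]) (hnz z hz)
      (t * (q.eval z * Pt Q z ^ (M + r))) _ rfl
    convert this using 2
    · ext j
      rw [(hd1 j z (hUD hz)).deriv, (hd2 j z (hUD hz)).deriv]
      simp
      ring
    · rw [dotProduct]
      apply Finset.sum_congr rfl
      intro j _
      rw [(hd1 j z (hUD hz)).deriv, (hd2 j z (hUD hz)).deriv]
      simp
      ring
  · have hE1 : (Ev0 U fun z j => deriv (fun w => a j * Fu w - b j * Fv w) z) x = Ψ q := by
      ext ⟨z, hz⟩
      have hlin : ∀ A B : ℂ, ∑ j, x.1 j * (a j * A - b j * B) =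
          (x.1 ⬝ᵥ a) * A - (x.1 ⬝ᵥ b) * B := by
        intro A B
        simp only [dotProduct, Finset.sum_mul, ← Finset.sum_sub_distrib]
        exact Finset.sum_congr rfl fun j _ => by ring
      simp only [Ev0, LinearMap.coe_mk, AddHom.coe_mk, Ψ, κ]
      rw [Finset.sum_congr rfl fun j _ => by rw [(hd1 j z (hUD hz)).deriv], hlin]
      ring
    have hdrop := rank_drop (Ev U g)
      (Ev0 U fun z j => deriv (fun w => a j * Fu w - b j * Fv w) z)
      (Ev0 U fun z j => deriv (fun w => (-(1 / 2) * a j) * Fw w) z) x (LinearMap.mem_ker.1 hx)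
      (by rw [hE1]; exact hq)
    filter_upwards [hdrop] with t ht
    have hEv : Ev U (fun z j => g z j + t * deriv (fun w => a j * Fu w - b j * Fv w) z +
          t ^ 2 * deriv (fun w => (-(1 / 2) * a j) * Fw w) z) =
        Ev U g + t • (Ev0 U fun z j => deriv (fun w => a j * Fu w - b j * Fv w) z) +
          t ^ 2 • (Ev0 U fun z j => deriv (fun w => (-(1 / 2) * a j) * Fw w) z) := by
      apply LinearMap.ext
      intro y
      ext ⟨z, hz⟩
      simp only [Ev, Ev0, LinearMap.coe_mk, AddHom.coe_mk, LinearMap.add_apply,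
        LinearMap.smul_apply, Pi.add_apply, Pi.smul_apply, smul_eq_mul, Finset.mul_sum, mul_add,
        Finset.sum_add_distrib, mul_left_comm]
      ring
    rw [hEv]
    exact ht

theorem exists_full (n : ℕ) (hn : 3 ≤ n) (C : Finset ℂ) (ρ : ℂ → ℝ) (hρ : ∀ c, 0 < ρ c)
    (D : Set ℂ) (hD : D = ⋃ c ∈ C, Metric.ball c (ρ c)) (hDo : IsOpen D)
    (Q : Finset ℂ) (hQC : Q ⊆ C)
    (U : Set ℂ) (hU : IsOpen U) (hUD : U ⊆ D) (hUne : U.Nonempty)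
    (f : ℂ → Fin n → ℂ) (M r : ℕ) (hM : ∀ j, DifferentiableOn ℂ (fun z => Pt Q z ^ M * f z j) D)
    (hfc : ∀ j, ContinuousOn (fun z => f z j) U)
    (K : Set ℂ) (hK : IsCompact K) (hKD : K ⊆ D) (ε : ℝ)
    (k : ℕ) (F : ℂ → Fin n → ℂ)
    (hF : ∀ j, DifferentiableOn ℂ (fun z => F z j) D)
    (hFO : ∀ p ∈ Q, ∀ j, (fun z => F z j) =O[𝓝 p] fun z => (z - p) ^ r)
    (hFε : ∃ ε' < ε, ∀ z ∈ K, ‖F z‖ ≤ ε')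
    (hnz : ∀ z ∈ U, (fun j => f z j + deriv (fun w => F w j) z) ≠ 0)
    (hnull : ∀ z ∈ U, ∑ j, (f z j + deriv (fun w => F w j) z) ^ 2 = 0)
    (hk : Module.finrank ℂ (LinearMap.ker
      (Ev U fun z j => f z j + deriv (fun w => F w j) z)) = k) :
    ∃ F : ℂ → Fin n → ℂ,
      (∀ j, DifferentiableOn ℂ (fun z => F z j) D) ∧
      (∀ p ∈ Q, ∀ j, (fun z => F z j) =O[𝓝 p] fun z => (z - p) ^ r) ∧
      (∀ z ∈ K, ‖F z‖ < ε) ∧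
      (∀ z ∈ U, (fun j => f z j + deriv (fun w => F w j) z) ≠ 0) ∧
      (∀ z ∈ U, ∑ j, (f z j + deriv (fun w => F w j) z) ^ 2 = 0) ∧
      LinearMap.ker (Ev U fun z j => f z j + deriv (fun w => F w j) z) = ⊥ := by
  induction k using Nat.strong_induction_on generalizing F with
  | _ k ih =>
  obtain ⟨ε', hε', hFK⟩ := hFε
  by_cases hker : LinearMap.ker (Ev U fun z j => f z j + deriv (fun w => F w j) z) = ⊥
  · exact ⟨F, hF, hFO, fun z hz => (hFK z hz).trans_lt hε', hnz, hnull, hker⟩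
  have hdF : ∀ j, DifferentiableOn ℂ (fun z => deriv (fun w => F w j) z) D := fun j =>
    (hF j).deriv hDo
  obtain ⟨F1, F2, h1, h2, hO1, hO2, hgood, hrank⟩ := exists_step n hn C ρ hρ D hD hDo Q hQC U hU
    hUD hUne (fun z j => f z j + deriv (fun w => F w j) z) M r
    (fun j => by
      simp only [mul_add]
      exact (hM j).add (((Pt_diff Q).pow M).differentiableOn.mul (hdF j)))
    (fun j => (hfc j).add ((hdF j).continuousOn.mono hUD)) hnz hnull hker
  have hbdd : ∀ G : ℂ → Fin n → ℂ, (∀ j, DifferentiableOn ℂ (fun z => G z j) D) →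
      ∃ B, ∀ z ∈ K, ‖G z‖ ≤ B := fun G hG =>
    hK.exists_bound_of_continuousOn
      (continuousOn_pi.2 fun j => (hG j).continuousOn.mono hKD)
  obtain ⟨B1, hB1⟩ := hbdd F1 h1
  obtain ⟨B2, hB2⟩ := hbdd F2 h2
  have hsmall : ∀ᶠ t : ℂ in 𝓝 0, ‖t‖ * B1 + ‖t‖ ^ 2 * B2 < ε - ε' := by
    have hc : ContinuousAt (fun t : ℂ => ‖t‖ * B1 + ‖t‖ ^ 2 * B2) 0 := by fun_prop
    apply hc.eventually_lt_const
    simpa using hε'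
  obtain ⟨t, ht1, ht2⟩ := (hrank.and (hsmall.filter_mono nhdsWithin_le_nhds)).exists
  have hder : ∀ z ∈ D, ∀ j, deriv (fun w => F w j + t * F1 w j + t ^ 2 * F2 w j) z =
      deriv (fun w => F w j) z + t * deriv (fun w => F1 w j) z +
        t ^ 2 * deriv (fun w => F2 w j) z := by
    intro z hz j
    have hz' := hDo.mem_nhds hz
    have e0 := ((hF j).differentiableAt hz').hasDerivAt
    have e1 := ((h1 j).differentiableAt hz').hasDerivAt
    have e2 := ((h2 j).differentiableAt hz').hasDerivAt
    exact ((e0.add (e1.const_mul t)).add (e2.const_mul (t ^ 2))).deriv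
  have hder2 : ∀ z ∈ D, ∀ j, f z j + deriv (fun w => F w j + t * F1 w j + t ^ 2 * F2 w j) z =
      f z j + deriv (fun w => F w j) z + t * deriv (fun w => F1 w j) z +
        t ^ 2 * deriv (fun w => F2 w j) z := by
    intro z hz j
    rw [hder z hz j]; ring
  have hEv : Ev U (fun z j => f z j + deriv (fun w => F w j + t * F1 w j + t ^ 2 * F2 w j) z) =
      Ev U (fun z j => f z j + deriv (fun w => F w j) z + t * deriv (fun w => F1 w j) z +
        t ^ 2 * deriv (fun w => F2 w j) z) := by
    apply LinearMap.ext
    intro y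
    ext ⟨z, hz⟩
    simp only [Ev, LinearMap.coe_mk, AddHom.coe_mk, hder2 z (hUD hz)]
  refine ih _ (hk ▸ ht1) (fun z j => F z j + t * F1 z j + t ^ 2 * F2 z j) ?_ ?_ ?_ ?_ ?_ ?_
  · exact fun j => ((hF j).add ((h1 j).const_mul t)).add ((h2 j).const_mul _)
  · exact fun p hp j => ((hFO p hp j).add ((hO1 p hp j).const_mul_left t)).add
      ((hO2 p hp j).const_mul_left _)
  · refine ⟨ε' + (‖t‖ * B1 + ‖t‖ ^ 2 * B2), by linarith, fun z hz => ?_⟩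
    have e : (fun j => F z j + t * F1 z j + t ^ 2 * F2 z j) = F z + t • F1 z + t ^ 2 • F2 z := by
      ext j; simp
    rw [e]
    refine (norm_add₃_le).trans ?_
    rw [norm_smul, norm_smul, norm_pow, add_assoc]
    have := hFK z hz
    have := hB1 z hz
    have := hB2 z hz
    gcongr
  · intro z hz
    have := (hgood t z hz).1
    simpa only [hder2 z (hUD hz)] using this
  · intro z hz
    have := (hgood t z hz).2
    simpa only [hder2 z (hUD hz)] using this
  · rw [hEv]

theorem merom_clear (Q E₀ : Finset ℂ) (hEQ : E₀ ⊆ Q) (D : Set ℂ) (hDo : IsOpen D) (f : ℂ → ℂ)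
    (hf : DifferentiableOn ℂ f (D \ E₀)) (hm : ∀ p ∈ E₀, MeromAt f p) :
    ∀ᶠ M : ℕ in atTop, DifferentiableOn ℂ (fun z => Pt Q z ^ M * f z) D := by
  have h1 : ∀ p ∈ E₀, ∀ᶠ M : ℕ in atTop, DifferentiableAt ℂ (fun z => Pt Q z ^ M * f z) p := by
    intro p hp
    obtain ⟨m, g, hg, hfg⟩ := hm p hp
    filter_upwards [eventually_ge_atTop (m + 1)] with M hM
    have hga := hg.differentiableAt
    have hd : DifferentiableAt ℂ
        (fun z => (∏ x ∈ Q.erase p, (z - x)) ^ M * ((z - p) ^ (M - m) * g z)) p := by fun_prop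
    apply hd.congr_of_eventuallyEq
    have hfg' := eventually_nhdsWithin_iff.1 hfg
    filter_upwards [hfg'] with z hz
    have hPt : Pt Q z = (z - p) * ∏ x ∈ Q.erase p, (z - x) :=
      (Finset.mul_prod_erase Q _ (hEQ hp)).symm
    by_cases hzp : z = p
    · subst hzp
      have hM0 : M ≠ 0 := by omega
      have hM1 : M - m ≠ 0 := by omega
      simp [hPt, hM0, hM1]
    · rw [hz hzp, hPt, mul_pow]
      have hne : z - p ≠ 0 := sub_ne_zero.2 hzp
      have : (z - p) ^ M = (z - p) ^ (M - m) * (z - p) ^ m := by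
        rw [← pow_add]; congr 1; omega
      rw [this]
      field_simp
  filter_upwards [(eventually_all_finset E₀).2 h1] with M hM
  intro z hz
  by_cases hzE : z ∈ E₀
  · exact (hM z hzE).differentiableWithinAt
  · have hz' : D \ (E₀ : Set ℂ) ∈ 𝓝 z :=
      (hDo.sdiff E₀.finite_toSet.isClosed).mem_nhds ⟨hz, hzE⟩
    exact ((((Pt_diff Q) z).pow M).mul (hf.differentiableAt hz')).differentiableWithinAt


theorem wirt_add_re {u : ℂ → ℝ} {F : ℂ → ℂ} {F' z : ℂ} (hu : DifferentiableAt ℝ u z)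
    (hF : HasDerivAt F F' z) : wirt (fun w => u w + (F w).re) z = wirt u z + F' := by
  have h1 := Complex.reCLM.hasFDerivAt.comp z (hF.hasFDerivAt.restrictScalars ℝ)
  have h2 := (hu.hasFDerivAt.add h1).fderiv
  have h3 : (fun w => u w + (F w).re) = u + (Complex.reCLM ∘ F) := rfl
  unfold wirt
  rw [h3, h2]
  apply Complex.ext
  · simp
  · simp
    ring

/-- planar case of Theorem 3.1, Mergelyan's theorem for complete minimal
surfaces of finite total curvature, for a compact domain without arcs.  Given a connected
compact `K ⊂ ℂ`, disjoint finite sets `E₀, Λ ⊆ K`, and a conformal minimal immersion `X`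
on `W \ E₀` (`W ⊇ K` open) that is complete of finite total curvature near `E₀` (its
derivative data is meromorphic at each point of `E₀` with at least one component having a
pole), for every `ε > 0` and `r ∈ ℕ` there are a neighborhood `W′ ⊆ W` of `K` and a
conformal minimal immersion `Y` on `W′ \ E₀` such that:
(i) `∂Y` is full; (ii) `∂Y` is meromorphic at each `p ∈ E₀` with at least one component
having a pole, and `∂Y − ∂X` extends holomorphically to `W′`; (iii) `Y − X` extends
continuously to `K` with `sup_K ‖Y − X‖ < ε`; (iv) `‖Y − X‖ = O(|z − p|^r)` as `z → p`
for every `p ∈ E₀ ∪ Λ`; (v) `∂Y − ∂X` admits a holomorphic primitive on `W′ \ E₀`. -/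
theorem statement_9 (n : ℕ) (hn : 3 ≤ n)
    (K : Set ℂ) (hKcpt : IsCompact K) (hKconn : IsConnected K)
    (E₀ Λ : Finset ℂ) (hdis : Disjoint E₀ Λ) (hE₀K : ↑E₀ ⊆ K) (hΛK : ↑Λ ⊆ K)
    (W : Set ℂ) (hW : IsOpen W) (hKW : K ⊆ W)
    (X : ℂ → Fin n → ℝ) (hX : IsCMI n (W \ ↑E₀) X)
    (hXm : ∀ p ∈ E₀, ∀ j, MeromAt (fun z => ddata n X z j) p)
    (hXpole : ∀ p ∈ E₀, ∃ j, IsPole (fun z => ddata n X z j) p)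
    (ε : ℝ) (hε : 0 < ε) (r : ℕ) :
    ∃ W' : Set ℂ, IsOpen W' ∧ K ⊆ W' ∧ W' ⊆ W ∧
    ∃ Y : ℂ → Fin n → ℝ, IsCMI n (W' \ ↑E₀) Y ∧
      -- (i) ∂Y is full
      (∀ (α : Fin n → ℂ) (β : ℂ), α ≠ 0 →
        ∃ z ∈ W' \ (↑E₀ : Set ℂ), ∑ j, α j * ddata n Y z j ≠ β) ∧
      -- (ii) meromorphic at E₀, with a pole, and ∂Y − ∂X extends holomorphically to W′
      (∀ p ∈ E₀, ∀ j, MeromAt (fun z => ddata n Y z j) p) ∧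
      (∀ p ∈ E₀, ∃ j, IsPole (fun z => ddata n Y z j) p) ∧
      (∃ φ : ℂ → Fin n → ℂ, (∀ j, DifferentiableOn ℂ (fun z => φ z j) W') ∧
        ∀ z ∈ W' \ (↑E₀ : Set ℂ), φ z = fun j => ddata n Y z j - ddata n X z j) ∧
      -- (iii) continuous extension of Y − X to K with small sup-norm
      (∃ h : ℂ → Fin n → ℝ, ContinuousOn h K ∧
        (∀ z ∈ K \ (↑E₀ : Set ℂ), h z = fun j => Y z j - X z j) ∧
        (∀ z ∈ K, ‖h z‖ < ε)) ∧
      -- (iv) interpolation to order r at E₀ ∪ Λ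
      (∀ p ∈ (↑E₀ ∪ ↑Λ : Set ℂ), Asymptotics.IsBigO (𝓝[≠] p)
        (fun z => fun j => Y z j - X z j) (fun z => (z - p) ^ r)) ∧
      -- (v) ∂Y − ∂X has a holomorphic primitive on W′ \ E₀ (same flux)
      (∃ F : ℂ → Fin n → ℂ, ∀ j, ∀ z ∈ W' \ (↑E₀ : Set ℂ),
        HasDerivAt (fun w => F w j) (ddata n Y z j - ddata n X z j) z) := by
  classical
  -- a neighbourhood of `K` that is a finite union of discs
  have hball : ∀ c : ℂ, ∃ ρ > 0, c ∈ K → Metric.ball c ρ ⊆ W := by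
    intro c
    by_cases hc : c ∈ K
    · obtain ⟨ρ, hρ, h⟩ := Metric.isOpen_iff.1 hW c (hKW hc)
      exact ⟨ρ, hρ, fun _ => h⟩
    · exact ⟨1, one_pos, fun h => absurd h hc⟩
  choose ρ hρ hρW using hball
  obtain ⟨C₀, hC₀K, hKC₀⟩ := hKcpt.elim_nhds_subcover (fun c => Metric.ball c (ρ c))
    (fun c _ => Metric.ball_mem_nhds c (hρ c))
  let Q : Finset ℂ := E₀ ∪ Λ
  let C : Finset ℂ := C₀ ∪ Q
  let D : Set ℂ := ⋃ c ∈ C, Metric.ball c (ρ c)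
  have hDo : IsOpen D := isOpen_biUnion fun c _ => Metric.isOpen_ball
  have hQC : Q ⊆ C := Finset.subset_union_right
  have hCK : ∀ c ∈ C, c ∈ K := by
    intro c hc
    rcases Finset.mem_union.1 hc with h | h
    · exact hC₀K c h
    · rcases Finset.mem_union.1 h with h | h
      · exact hE₀K h
      · exact hΛK h
  have hDW : D ⊆ W := Set.iUnion₂_subset fun c hc => hρW c (hCK c hc)
  have hKD : K ⊆ D := hKC₀.trans
    (Set.biUnion_subset_biUnion_left fun c hc => Finset.mem_union_left _ hc)
  have hUo : IsOpen (D \ (E₀ : Set ℂ)) := hDo.sdiff E₀.finite_toSet.isClosed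
  have hUW : D \ (E₀ : Set ℂ) ⊆ W \ (E₀ : Set ℂ) := Set.sdiff_subset_sdiff_left hDW
  have hUne : (D \ (E₀ : Set ℂ)).Nonempty := by
    obtain ⟨x, hx⟩ := hKconn.nonempty
    exact ((infinite_of_mem_nhds x (hDo.mem_nhds (hKD hx))).sdiff E₀.finite_toSet).nonempty
  obtain ⟨hXs, hXd, hXnz, hXnull⟩ := hX
  have hXd' : ∀ j, DifferentiableOn ℂ (fun z => ddata n X z j) (D \ (E₀ : Set ℂ)) :=
    fun j => (hXd j).mono hUW
  obtain ⟨M, hM⟩ := (eventually_all.2 fun j => merom_clear Q E₀ Finset.subset_union_left D hDo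
    (fun z => ddata n X z j) (hXd' j) (fun p hp => hXm p hp j)).exists
  obtain ⟨F, hF, hFO, hFε, hFnz, hFnull, hFker⟩ := exists_full n hn C ρ hρ D rfl hDo Q hQC
    (D \ (E₀ : Set ℂ)) hUo Set.sdiff_subset hUne (ddata n X) M r hM
    (fun j => (hXd' j).continuousOn) K hKcpt hKD ε _ (fun _ _ => 0)
    (fun j => differentiableOn_const 0) (fun p _ j => Asymptotics.isBigO_zero _ _)
    ⟨0, hε, fun z _ => by
      have : (fun _ => 0 : Fin n → ℂ) = 0 := rfl
      rw [this, norm_zero]⟩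
    (fun z hz => by simpa using hXnz z (hUW hz))
    (fun z hz => by simpa using hXnull z (hUW hz)) rfl
  have hdF : ∀ j, DifferentiableOn ℂ (fun z => deriv (fun w => F w j) z) D := fun j =>
    (hF j).deriv hDo
  have hFd : ∀ j, ∀ z ∈ D, HasDerivAt (fun w => F w j) (deriv (fun w => F w j) z) z :=
    fun j z hz => ((hF j).differentiableAt (hDo.mem_nhds hz)).hasDerivAt
  let Y : ℂ → Fin n → ℝ := fun z j => X z j + (F z j).re
  have hXdiff : ∀ z ∈ D \ (E₀ : Set ℂ), ∀ j, DifferentiableAt ℝ (fun w => X w j) z := by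
    intro z hz j
    have h1 : ContDiffAt ℝ (⊤ : ℕ∞) X z := hXs.contDiffAt
      ((hW.sdiff E₀.finite_toSet.isClosed).mem_nhds (hUW hz))
    exact differentiableAt_pi.1 (h1.differentiableAt (by simp)) j
  have hYdd : ∀ z ∈ D \ (E₀ : Set ℂ), ∀ j,
      ddata n Y z j = ddata n X z j + deriv (fun w => F w j) z := fun z hz j =>
    wirt_add_re (hXdiff z hz j) (hFd j z hz.1)
  have hYdd' : ∀ z ∈ D \ (E₀ : Set ℂ),
      ddata n Y z = fun j => ddata n X z j + deriv (fun w => F w j) z := fun z hz =>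
    funext (hYdd z hz)
  have hpunct : ∀ p ∈ E₀, ∀ᶠ z in 𝓝[≠] p, z ∈ D \ (E₀ : Set ℂ) := by
    intro p hp
    have h1 : D ∈ 𝓝 p := hDo.mem_nhds (hKD (hE₀K hp))
    have h2 : ((E₀.erase p : Finset ℂ) : Set ℂ)ᶜ ∈ 𝓝 p :=
      (E₀.erase p).finite_toSet.isClosed.isOpen_compl.mem_nhds (by simp)
    filter_upwards [mem_nhdsWithin_of_mem_nhds h1, mem_nhdsWithin_of_mem_nhds h2,
      self_mem_nhdsWithin] with z hz1 hz2 hz3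
    refine ⟨hz1, fun hzE => hz2 ?_⟩
    exact Finset.mem_coe.2 (Finset.mem_erase.2 ⟨hz3, Finset.mem_coe.1 hzE⟩)
  have hdFan : ∀ p ∈ E₀, ∀ j, AnalyticAt ℂ (fun z => deriv (fun w => F w j) z) p :=
    fun p hp j => (hdF j).analyticAt (hDo.mem_nhds (hKD (hE₀K hp)))
  refine ⟨D, hDo, hKD, hDW, Y, ⟨?_, ?_, ?_, ?_⟩, ?_, ?_, ?_, ?_, ?_, ?_, ?_⟩
  · -- smoothness
    rw [contDiffOn_pi]
    intro j
    refine (contDiffOn_pi.1 (hXs.mono hUW) j).add ?_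
    have h1 : ContDiffOn ℂ (⊤ : ℕ∞) (fun z => F z j) D := (hF j).contDiffOn hDo
    exact Complex.reCLM.contDiff.comp_contDiffOn ((h1.restrict_scalars ℝ).mono Set.sdiff_subset)
  · intro j
    exact ((hXd' j).add ((hdF j).mono Set.sdiff_subset)).congr fun z hz => hYdd z hz j
  · intro z hz
    rw [hYdd' z hz]
    exact hFnz z hz
  · intro z hz
    rw [hYdd' z hz]
    exact hFnull z hz
  · -- fullness
    intro α β hα
    by_contra hcon
    push Not at hcon
    have hmem : (α, β) ∈ LinearMap.ker (Ev (D \ (E₀ : Set ℂ))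
        fun z j => ddata n X z j + deriv (fun w => F w j) z) := by
      rw [mem_ker_Ev]
      intro z hz
      have := hcon z hz
      rw [hYdd' z hz] at this
      exact this
    rw [hFker] at hmem
    exact hα (congrArg Prod.fst ((Submodule.mem_bot ℂ).1 hmem))
  · -- meromorphic
    intro p hp j
    obtain ⟨m, g, hg, hgf⟩ := hXm p hp j
    have han := hdFan p hp j
    refine ⟨m, fun z => g z + (z - p) ^ m * deriv (fun w => F w j) z, by fun_prop, ?_⟩
    filter_upwards [hgf, hpunct p hp, self_mem_nhdsWithin] with z hz1 hz2 hz3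
    have hne : z - p ≠ 0 := sub_ne_zero.2 hz3
    rw [hYdd z hz2 j, hz1]
    field_simp
  · -- poles
    intro p hp
    obtain ⟨j, m, hm, g, hg, hg0, hgf⟩ := hXpole p hp
    have han := hdFan p hp j
    refine ⟨j, m, hm, fun z => g z + (z - p) ^ m * deriv (fun w => F w j) z, by fun_prop, ?_, ?_⟩
    · have : m ≠ 0 := by omega
      simpa [this] using hg0
    filter_upwards [hgf, hpunct p hp, self_mem_nhdsWithin] with z hz1 hz2 hz3
    have hne : z - p ≠ 0 := sub_ne_zero.2 hz3
    rw [hYdd z hz2 j, hz1]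
    field_simp
  · refine ⟨fun z j => deriv (fun w => F w j) z, hdF, fun z hz => ?_⟩
    ext j
    rw [hYdd z hz j]; ring
  · refine ⟨fun z j => (F z j).re, ?_, ?_, ?_⟩
    · exact continuousOn_pi.2 fun j =>
        Complex.continuous_re.comp_continuousOn ((hF j).continuousOn.mono hKD)
    · intro z _
      ext j
      simp [Y]
    · intro z hz
      refine lt_of_le_of_lt ?_ (hFε z hz)
      rw [pi_norm_le_iff_of_nonneg (norm_nonneg _)]
      intro j
      exact (Complex.abs_re_le_norm _).trans (norm_le_pi_norm (F z) j)
  · intro p hp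
    have hpQ : p ∈ Q := by
      simpa [Q] using hp
    rw [Asymptotics.isBigO_pi]
    intro j
    have h1 : (fun z => Y z j - X z j) = fun z => (F z j).re := by
      ext z; simp [Y]
    rw [h1]
    refine Asymptotics.IsBigO.trans ?_ ((hFO p hpQ j).mono nhdsWithin_le_nhds)
    exact Asymptotics.IsBigO.of_bound 1 (Eventually.of_forall fun z => by
      simpa using Complex.abs_re_le_norm (F z j))
  · refine ⟨F, fun j z hz => ?_⟩
    rw [hYdd z hz j, add_sub_cancel_left]
    exact hFd j z hz.1
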